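/- arXiv:2012.10332 — 11 statements merged into one kernel-verified Lean document; each statement's English description precedes it below -/
import Mathlib

section
/- Let f(n) = a n² + b n + c with a, b, c ∈ ℤ, a ≠ 0, a even and b odd. Then the sequence of 2-adic valuations (ν₂(f(n)))_{n≥0} is unbounded: for every N ∈ ℕ there exists n ∈ ℕ such that 2^N divides f(n). -/
/-- If `a` is even and `b` is odd, then the sequence of 2-adic valuations of
`f(n) = a n² + b n + c` is unbounded: for every `N` there is `n` with `2^N ∣ f(n)`. -/
theorem stmt_2 (a b c : ℤ) (ha0 : a ≠ 0) (ha : Even a) (hb : Odd b) :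
    ∀ N : ℕ, ∃ n : ℕ, (2 : ℤ) ^ N ∣ (a * (n : ℤ) ^ 2 + b * (n : ℤ) + c) := by
  intro N
  induction N with
  | zero => exact ⟨0, by simp⟩
  | succ N ih =>
    obtain ⟨n, k, hk⟩ := ih
    rcases Int.even_or_odd k with hk2 | hk2
    · refine ⟨n, ?_⟩
      rw [hk, pow_succ]
      exact mul_dvd_mul_left _ hk2.two_dvd
    · refine ⟨n + 2 ^ N, ?_⟩
      have hodd : Odd (a * (2 * n + 2 ^ N) + b) := (ha.mul_right _).add_odd hb
      have hstep : a * ((n + 2 ^ N : ℕ) : ℤ) ^ 2 + b * ((n + 2 ^ N : ℕ) : ℤ) + c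
          = 2 ^ N * (k + (a * (2 * n + 2 ^ N) + b)) := by
        push_cast
        linear_combination hk
      rw [hstep, pow_succ]
      exact mul_dvd_mul_left _ (hk2.add_odd hodd).two_dvd
end

section
/- Let f(n) = a n² + b n + c with a, b, c ∈ ℤ, a odd, b odd, and c even. Then the sequence of 2-adic valuations (ν₂(f(n)))_{n≥0} is unbounded: for every N ∈ ℕ there exists n ∈ ℕ such that 2^N divides f(n). -/
/-- Hensel lifting of a root modulo `2 ^ (N + 1)` of a quadratic whose linear coefficient is odd. -/
lemma exists_two_pow_succ_dvd_quadratic (a b c : ℤ) (hb : Odd b) (hc : Even c) (N : ℕ) :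
    ∃ n : ℕ, (2 : ℤ) ^ (N + 1) ∣ a * (n : ℤ) ^ 2 + b * (n : ℤ) + c := by
  induction N with
  | zero => exact ⟨0, by simpa using hc.two_dvd⟩
  | succ N ih =>
    obtain ⟨n, k, hk⟩ := ih
    rcases Int.even_or_odd' k with ⟨m, rfl | rfl⟩
    · exact ⟨n, m, by rw [hk]; ring⟩
    · obtain ⟨d, rfl⟩ := hb
      refine ⟨n + 2 ^ (N + 1), m + a * n + d + 1 + a * 2 ^ N, ?_⟩
      push_cast
      linear_combination hk

/-- If `a` and `b` are odd and `c` is even, then the sequence of 2-adic valuations of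
`f(n) = a n² + b n + c` is unbounded: for every `N` there is `n` with `2^N ∣ f(n)`. -/
theorem stmt_3 (a b c : ℤ) (ha : Odd a) (hb : Odd b) (hc : Even c) :
    ∀ N : ℕ, ∃ n : ℕ, (2 : ℤ) ^ N ∣ (a * (n : ℤ) ^ 2 + b * (n : ℤ) + c) := by
  intro N
  obtain ⟨n, hn⟩ := exists_two_pow_succ_dvd_quadratic a b c hb hc N
  exact ⟨n, (pow_dvd_pow 2 N.le_succ).trans hn⟩
end

section
/- Let f(n) = a n² + b n + c with a, b, c ∈ ℤ, a odd, b even, and b² − 4ac = 0. Then the sequence of 2-adic valuations (ν₂(f(n)))_{n≥0} is unbounded: for every N ∈ ℕ there exists n ∈ ℕ such that 2^N divides f(n). -/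
/-- A linear congruence `a n + k ≡ 0` modulo `m` with `a` coprime to `m` has a solution in `ℕ`. -/
lemma exists_nat_dvd_mul_add {a m : ℤ} (hm : 0 < m) (h : IsCoprime a m) (k : ℤ) :
    ∃ n : ℕ, m ∣ a * (n : ℤ) + k := by
  obtain ⟨u, v, huv⟩ := h
  refine ⟨((-u * k) % m).toNat, ?_⟩
  rw [Int.toNat_of_nonneg (Int.emod_nonneg _ hm.ne')]
  refine ⟨v * k - a * ((-u * k) / m), ?_⟩
  linear_combination a * Int.emod_add_mul_ediv (-u * k) m - k * huv

/-- If `a` is odd, `b` is even, and `b² − 4ac = 0`, then the sequence of 2-adic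
valuations of `f(n) = a n² + b n + c` is unbounded. -/
theorem stmt_4 (a b c : ℤ) (ha : Odd a) (hb : Even b) (hdisc : b ^ 2 - 4 * a * c = 0) :
    ∀ N : ℕ, ∃ n : ℕ, (2 : ℤ) ^ N ∣ (a * (n : ℤ) ^ 2 + b * (n : ℤ) + c) := by
  intro N
  obtain ⟨k, rfl⟩ := hb
  have hcop : IsCoprime a ((2 : ℤ) ^ N) := (Int.isCoprime_two_right.mpr ha).pow_right
  obtain ⟨n, hn⟩ := exists_nat_dvd_mul_add (by positivity) hcop k
  have hsq : a * (a * (n : ℤ) ^ 2 + (k + k) * n + c) = (a * n + k) * (a * n + k) := by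
    linarith
  exact ⟨n, hcop.symm.dvd_of_dvd_mul_left (hsq ▸ hn.mul_right _)⟩
end

section
/- Let f(n) = a n² + b n + c with a, b, c ∈ ℤ, a odd, b even, and suppose b² − 4ac = 4^ℓ · Δ for some positive integer ℓ and some integer Δ with Δ ≡ 1 (mod 8). Then the sequence of 2-adic valuations (ν₂(f(n)))_{n≥0} is unbounded: for every N ∈ ℕ there exists n ∈ ℕ such that 2^N divides f(n). -/
/-- An integer congruent to `1` modulo `8` is a square modulo every power of `2`. -/
theorem exists_odd_two_pow_dvd_sq_sub {d : ℤ} (hd : d % 8 = 1) (N : ℕ) :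
    ∃ x : ℤ, Odd x ∧ (2 : ℤ) ^ (N + 3) ∣ x ^ 2 - d := by
  induction N with
  | zero => exact ⟨1, odd_one, by norm_num; omega⟩
  | succ N ih =>
    obtain ⟨x, ⟨y, rfl⟩, t, ht⟩ := ih
    rcases Int.even_or_odd' t with ⟨s, rfl | rfl⟩
    · exact ⟨2 * y + 1, ⟨y, rfl⟩, s, by rw [ht]; ring⟩
    · refine ⟨2 * y + 1 + 2 ^ (N + 2), ⟨y + 2 ^ (N + 1), by ring⟩, s + 1 + y + 2 ^ N, ?_⟩
      linear_combination ht

/-- A linear congruence with odd leading coefficient has a natural number solution modulo every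
power of `2`. -/
theorem exists_nat_two_pow_dvd_mul_sub {a : ℤ} (ha : Odd a) (r : ℤ) (N : ℕ) :
    ∃ n : ℕ, (2 : ℤ) ^ N ∣ a * n - r := by
  obtain ⟨u, v, huv⟩ : IsCoprime a (2 ^ N) := (Int.isCoprime_two_right.mpr ha).pow_right
  refine ⟨(u * r % 2 ^ N).toNat, ?_⟩
  rw [Int.toNat_of_nonneg (Int.emod_nonneg _ (by positivity))]
  refine ⟨-(v * r) - a * (u * r / 2 ^ N), ?_⟩
  linear_combination r * huv + a * Int.emod_add_mul_ediv (u * r) (2 ^ N)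

/-- If `a` is odd, `b` is even, and `b² − 4ac = 4^ℓ · Δ` with `ℓ ≥ 1` and
`Δ ≡ 1 (mod 8)`, then the sequence of 2-adic valuations of `f(n) = a n² + b n + c`
is unbounded. -/
theorem stmt_5 (a b c : ℤ) (ha : Odd a) (hb : Even b) (ℓ : ℕ) (hℓ : 1 ≤ ℓ) (Δ : ℤ)
    (hΔ : Δ % 8 = 1) (hdisc : b ^ 2 - 4 * a * c = 4 ^ ℓ * Δ) :
    ∀ N : ℕ, ∃ n : ℕ, (2 : ℤ) ^ N ∣ (a * (n : ℤ) ^ 2 + b * (n : ℤ) + c) := by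
  intro N
  obtain ⟨m, rfl⟩ := Nat.exists_eq_add_of_le' hℓ
  obtain ⟨k, rfl⟩ := even_iff_exists_two_mul.mp hb
  have hk : k ^ 2 - a * c = (2 ^ m) ^ 2 * Δ := by
    have h4 : (4 : ℤ) ^ (m + 1) = 4 * (2 ^ m) ^ 2 := by
      rw [pow_succ, ← pow_mul, mul_comm m, pow_mul]; ring
    rw [h4] at hdisc
    linarith
  obtain ⟨x, -, hx⟩ := exists_odd_two_pow_dvd_sq_sub hΔ N
  obtain ⟨n, hn⟩ := exists_nat_two_pow_dvd_mul_sub ha (2 ^ m * x - k) N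
  refine ⟨n, IsCoprime.dvd_of_dvd_mul_left
    (Int.isCoprime_two_right.mpr ha).pow_right.symm ?_⟩
  have key : a * (a * (n : ℤ) ^ 2 + 2 * k * n + c) =
      (a * n - (2 ^ m * x - k)) * (a * n + k + 2 ^ m * x) + (2 ^ m) ^ 2 * (x ^ 2 - Δ) := by
    linear_combination -hk
  rw [key]
  exact dvd_add (hn.mul_right _) (((pow_dvd_pow 2 (Nat.le_add_right N 3)).trans hx).mul_left _)
end

section
/- Let f(n) = a n² + b n + c with a, b, c ∈ ℤ, a odd, b even, and suppose b² − 4ac = 4^ℓ · Δ for a positive integer ℓ and an integer Δ whose residue m = Δ mod 8 lies in {2, 3, 5, 6, 7}. Then f(n) ≠ 0 for all n ∈ ℕ, the sequence (ν₂(f(n)))_{n≥0} is bounded, it is periodic with period 2^ℓ (i.e., ν₂(f(n + 2^ℓ)) = ν₂(f(n)) for all n ∈ ℕ), and 2^ℓ is the minimal period: there is no positive integer T < 2^ℓ with ν₂(f(n + T)) = ν₂(f(n)) for all n ∈ ℕ. -/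
/-- The squares modulo `8` are `0`, `1` and `4`, according to the class of the root modulo `4`. -/
theorem Int.sq_emod_eight (x : ℤ) :
    (x % 2 = 1 ∧ x ^ 2 % 8 = 1) ∨ (x % 2 = 0 ∧ (x ^ 2 % 8 = 0 ∨ x ^ 2 % 8 = 4)) := by
  have h : x % 8 = 0 ∨ x % 8 = 1 ∨ x % 8 = 2 ∨ x % 8 = 3 ∨ x % 8 = 4 ∨ x % 8 = 5 ∨ x % 8 = 6 ∨
      x % 8 = 7 := by omega
  have hx := Int.mul_emod x x 8
  rw [pow_two]
  rcases h with h | h | h | h | h | h | h | h <;> rw [h] at hx <;> omega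

theorem Int.even_sq_sub_four_pow_succ_mul {x Δ : ℤ} {L : ℕ}
    (h : (2 : ℤ) ∣ x ^ 2 - 4 ^ (L + 1) * Δ) : ∃ y, x = 2 * y := by
  have h2 : (2 : ℤ) ∣ x ^ 2 := by
    have h4 : (2 : ℤ) ∣ 4 ^ (L + 1) * Δ := ⟨2 * 4 ^ L * Δ, by ring⟩
    exact (dvd_sub_left h4).mp h
  exact Int.prime_two.dvd_of_dvd_pow h2

theorem Int.two_mul_sq_sub_four_pow_succ_mul (y Δ : ℤ) (L : ℕ) :
    (2 * y) ^ 2 - 4 ^ (L + 1) * Δ = 2 ^ 2 * (y ^ 2 - 4 ^ L * Δ) := by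
  ring

theorem Int.not_two_pow_dvd_sq_sub_four_pow_mul {Δ : ℤ}
    (hm : Δ % 8 = 2 ∨ Δ % 8 = 3 ∨ Δ % 8 = 5 ∨ Δ % 8 = 6 ∨ Δ % 8 = 7) (L : ℕ) :
    ∀ x : ℤ, ¬ (2 : ℤ) ^ (2 * L + 3) ∣ x ^ 2 - 4 ^ L * Δ := by
  induction L with
  | zero =>
    intro x
    have := Int.sq_emod_eight x
    norm_num
    omega
  | succ L ih =>
    intro x h
    obtain ⟨y, rfl⟩ := Int.even_sq_sub_four_pow_succ_mul ((dvd_pow_self 2 (by omega)).trans h)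
    rw [Int.two_mul_sq_sub_four_pow_succ_mul, show 2 * (L + 1) + 3 = 2 + (2 * L + 3) by ring,
      pow_add] at h
    exact ih y (Int.dvd_of_mul_dvd_mul_left (by norm_num) h)

theorem Int.two_pow_dvd_sq_sub_four_pow_mul_add {Δ : ℤ}
    (hm : Δ % 8 = 2 ∨ Δ % 8 = 3 ∨ Δ % 8 = 5 ∨ Δ % 8 = 6 ∨ Δ % 8 = 7) (L : ℕ) :
    ∀ (x t : ℤ) (j : ℕ), (2 : ℤ) ^ j ∣ x ^ 2 - 4 ^ L * Δ →
      (2 : ℤ) ^ j ∣ (x + 2 ^ (L + 1) * t) ^ 2 - 4 ^ L * Δ := by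
  induction L with
  | zero =>
    intro x t j h
    have hx := Int.sq_emod_eight x
    have hy := Int.sq_emod_eight (x + 2 * t)
    have hj : j < 3 := by
      by_contra! hj
      exact Int.not_two_pow_dvd_sq_sub_four_pow_mul hm 0 x ((pow_dvd_pow 2 hj).trans h)
    interval_cases j <;> norm_num at h ⊢ <;> omega
  | succ L ih =>
    intro x t j h
    rcases j with _ | j
    · simp
    obtain ⟨y, rfl⟩ := Int.even_sq_sub_four_pow_succ_mul ((dvd_pow_self 2 (by omega)).trans h)
    rw [show 2 * y + 2 ^ (L + 1 + 1) * t = 2 * (y + 2 ^ (L + 1) * t) by ring]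
    rw [Int.two_mul_sq_sub_four_pow_succ_mul] at h ⊢
    rcases j with _ | j
    · exact (pow_dvd_pow 2 (by omega)).trans (dvd_mul_right (2 ^ 2) _)
    rw [show j + 1 + 1 = 2 + j by ring, pow_add] at h ⊢
    exact mul_dvd_mul_left _ (ih y t j (Int.dvd_of_mul_dvd_mul_left (by norm_num) h))

theorem Int.two_pow_dvd_sq_sub_four_pow_mul_iff {Δ : ℤ} (L : ℕ) :
    ∀ x : ℤ, (2 : ℤ) ^ (2 * L + 1) ∣ x ^ 2 - 4 ^ L * Δ ↔ ∃ z, x = 2 ^ L * (Δ + 2 * z) := by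
  induction L with
  | zero =>
    intro x
    have hx : x ^ 2 % 2 = x % 2 := by
      rcases Int.emod_two_eq_zero_or_one x with h | h <;> simp [pow_two, Int.mul_emod, h]
    norm_num
    constructor
    · intro h
      exact ⟨(x - Δ) / 2, by omega⟩
    · rintro ⟨z, hz⟩
      omega
  | succ L ih =>
    intro x
    have key : ∀ y : ℤ, (2 : ℤ) ^ (2 * (L + 1) + 1) ∣ (2 * y) ^ 2 - 4 ^ (L + 1) * Δ ↔
        (2 : ℤ) ^ (2 * L + 1) ∣ y ^ 2 - 4 ^ L * Δ := by
      intro y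
      rw [Int.two_mul_sq_sub_four_pow_succ_mul, show 2 * (L + 1) + 1 = 2 + (2 * L + 1) by ring,
        pow_add]
      exact mul_dvd_mul_iff_left (by norm_num)
    constructor
    · intro h
      obtain ⟨y, rfl⟩ := Int.even_sq_sub_four_pow_succ_mul ((dvd_pow_self 2 (by omega)).trans h)
      obtain ⟨z, rfl⟩ := (ih y).mp ((key y).mp h)
      exact ⟨z, by ring⟩
    · rintro ⟨z, rfl⟩
      rw [show (2 : ℤ) ^ (L + 1) * (Δ + 2 * z) = 2 * (2 ^ L * (Δ + 2 * z)) by ring, key, ih]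
      exact ⟨z, rfl⟩

theorem padicValInt_eq_of_pow_dvd_iff {p : ℕ} [Fact p.Prime] {x y : ℤ} (hx : x ≠ 0) (hy : y ≠ 0)
    (h : ∀ j : ℕ, (p : ℤ) ^ j ∣ x ↔ (p : ℤ) ^ j ∣ y) : padicValInt p x = padicValInt p y := by
  have hle : ∀ j : ℕ, j ≤ padicValInt p x ↔ j ≤ padicValInt p y := by
    intro j
    simpa [padicValInt_dvd_iff, hx, hy] using h j
  exact le_antisymm ((hle _).mp le_rfl) ((hle _).mpr le_rfl)


/-- Case 3(c) of Theorem 1: if `a` is odd, `b` is even, and `b² − 4ac = 4^ℓ · Δ` with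
`ℓ ≥ 1` and `Δ mod 8 ∈ {2,3,5,6,7}`, then `f(n) ≠ 0` for all `n`, the valuation
sequence `(ν₂(f(n)))` is bounded, periodic with period `2^ℓ`, and `2^ℓ` is the
minimal period. -/
theorem stmt_6 (a b c : ℤ) (ha : Odd a) (hb : Even b) (ℓ : ℕ) (hℓ : 1 ≤ ℓ) (Δ : ℤ)
    (hdisc : b ^ 2 - 4 * a * c = 4 ^ ℓ * Δ)
    (hm : Δ % 8 = 2 ∨ Δ % 8 = 3 ∨ Δ % 8 = 5 ∨ Δ % 8 = 6 ∨ Δ % 8 = 7) :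
    (∀ n : ℕ, a * (n : ℤ) ^ 2 + b * (n : ℤ) + c ≠ 0) ∧
    (∃ B : ℕ, ∀ n : ℕ, padicValInt 2 (a * (n : ℤ) ^ 2 + b * (n : ℤ) + c) ≤ B) ∧
    (∀ n : ℕ, padicValInt 2 (a * ((n + 2 ^ ℓ : ℕ) : ℤ) ^ 2 + b * ((n + 2 ^ ℓ : ℕ) : ℤ) + c) =
      padicValInt 2 (a * (n : ℤ) ^ 2 + b * (n : ℤ) + c)) ∧
    (∀ T : ℕ, 0 < T → T < 2 ^ ℓ →
      ¬ (∀ n : ℕ, padicValInt 2 (a * ((n + T : ℕ) : ℤ) ^ 2 + b * ((n + T : ℕ) : ℤ) + c) =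
        padicValInt 2 (a * (n : ℤ) ^ 2 + b * (n : ℤ) + c))) := by
  obtain ⟨k, rfl⟩ := hb
  obtain ⟨L, rfl⟩ : ∃ L, ℓ = L + 1 := ⟨ℓ - 1, by omega⟩
  have hk : k ^ 2 - a * c = 4 ^ L * Δ := by
    have h4 : (4 : ℤ) * (k ^ 2 - a * c) = 4 * (4 ^ L * Δ) := by linear_combination hdisc
    linarith
  have hcop : ∀ j : ℕ, IsCoprime ((2 : ℤ) ^ j) a := fun j =>
    (Int.isCoprime_iff_gcd_eq_one.mpr (Int.gcd_comm 2 a ▸ Int.isCoprime_iff_gcd_eq_one.mp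
      (Int.isCoprime_two_right.mpr ha))).pow_left
  have hdvd : ∀ (n : ℤ) (j : ℕ), (2 : ℤ) ^ j ∣ a * n ^ 2 + (k + k) * n + c ↔
      (2 : ℤ) ^ j ∣ (a * n + k) ^ 2 - 4 ^ L * Δ := by
    intro n j
    rw [← hk, show (a * n + k) ^ 2 - (k ^ 2 - a * c) = a * (a * n ^ 2 + (k + k) * n + c) by ring]
    exact ⟨fun h => h.mul_left a, (hcop j).dvd_of_dvd_mul_left⟩
  have hnot : ∀ n : ℤ, ¬ (2 : ℤ) ^ (2 * L + 3) ∣ a * n ^ 2 + (k + k) * n + c := fun n h =>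
    Int.not_two_pow_dvd_sq_sub_four_pow_mul hm L _ ((hdvd n _).mp h)
  have hne : ∀ n : ℤ, a * n ^ 2 + (k + k) * n + c ≠ 0 := fun n h => hnot n (h ▸ dvd_zero _)
  have hle : ∀ (n : ℤ) (j : ℕ), j ≤ padicValInt 2 (a * n ^ 2 + (k + k) * n + c) ↔
      (2 : ℤ) ^ j ∣ a * n ^ 2 + (k + k) * n + c := by
    intro n j
    have h := padicValInt_dvd_iff (p := 2) j (a * n ^ 2 + (k + k) * n + c)
    rw [or_iff_right (hne n)] at h
    exact_mod_cast h.symm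
  refine ⟨fun n => hne n, ⟨2 * L + 3, fun n => ?_⟩, fun n => ?_, fun T hT hTlt hper => ?_⟩
  · by_contra! h
    exact hnot n ((hle n _).mp h.le)
  · refine padicValInt_eq_of_pow_dvd_iff (hne _) (hne _) fun j => ?_
    simp only [Nat.cast_ofNat, hdvd]
    push_cast
    constructor <;> intro h
    · convert Int.two_pow_dvd_sq_sub_four_pow_mul_add hm L _ (-a) j h using 3
      ring
    · convert Int.two_pow_dvd_sq_sub_four_pow_mul_add hm L _ a j h using 3
      ring
  · obtain ⟨u, v, huv⟩ := hcop (L + 1)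
    obtain ⟨n, q, hn⟩ : ∃ (n : ℕ) (q : ℤ), (n : ℤ) = (2 ^ L * Δ - k) * v + 2 ^ (L + 1) * q := by
      refine ⟨((2 ^ L * Δ - k) * v % 2 ^ (L + 1)).toNat,
        -((2 ^ L * Δ - k) * v / 2 ^ (L + 1)), ?_⟩
      rw [Int.toNat_of_nonneg (Int.emod_nonneg _ (by positivity)), Int.emod_def]
      ring
    have hroot : (2 : ℤ) ^ (2 * L + 1) ∣ a * (n : ℤ) ^ 2 + (k + k) * n + c := by
      rw [hdvd, Int.two_pow_dvd_sq_sub_four_pow_mul_iff]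
      refine ⟨a * q - (2 ^ L * Δ - k) * u, ?_⟩
      rw [hn]
      linear_combination (2 ^ L * Δ - k) * huv
    have hroot' := hroot
    rw [← hle, ← hper n, hle, hdvd, Int.two_pow_dvd_sq_sub_four_pow_mul_iff] at hroot'
    rw [hdvd, Int.two_pow_dvd_sq_sub_four_pow_mul_iff] at hroot
    obtain ⟨z, hz⟩ := hroot
    obtain ⟨w, hw⟩ := hroot'
    have hTdvd : (2 : ℤ) ^ (L + 1) ∣ a * T := by
      refine ⟨w - z, ?_⟩
      push_cast at hw
      linear_combination hw - hz
    have : 2 ^ (L + 1) ∣ T := by exact_mod_cast (hcop (L + 1)).dvd_of_dvd_mul_left hTdvd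
    exact absurd (Nat.le_of_dvd hT this) (by omega)
end

section
/- Let f(n) = a n² + b n + c with a, b, c ∈ ℤ, a ≠ 0, a even and b odd. Then for every integer i ≥ 1 there exists a unique residue r with 0 ≤ r < 2^i such that 2^i divides f(n) for all n ∈ ℕ with n ≡ r (mod 2^i); moreover, for every n ∈ ℕ with n ≡ r (mod 2^{i−1}) but n ≢ r (mod 2^i), one has ν₂(f(n)) = i − 1. -/
/-- For `a` even and `b` odd, `n ↦ a n² + b n + c` preserves and reflects congruence
modulo every power of two. -/
theorem two_pow_dvd_quadratic_sub_iff {a b : ℤ} (ha : Even a) (hb : Odd b) (c : ℤ) (k : ℕ)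
    (x y : ℤ) :
    (2 : ℤ) ^ k ∣ (a * x ^ 2 + b * x + c) - (a * y ^ 2 + b * y + c) ↔ (2 : ℤ) ^ k ∣ x - y := by
  have hodd : Odd (a * (x + y) + b) := (ha.mul_right _).add_odd hb
  have hcop : IsCoprime ((2 : ℤ) ^ k) (a * (x + y) + b) :=
    (Int.isCoprime_two_left.mpr hodd).pow_left
  rw [show (a * x ^ 2 + b * x + c) - (a * y ^ 2 + b * y + c) = (x - y) * (a * (x + y) + b) by ring]
  exact ⟨hcop.dvd_of_dvd_mul_right, fun h => h.mul_right _⟩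

/-- For `a` even and `b` odd, `a n² + b n + c` has a root modulo every power of two. -/
theorem exists_lt_two_pow_dvd_quadratic {a b : ℤ} (ha : Even a) (hb : Odd b) (c : ℤ) (k : ℕ) :
    ∃ r : ℕ, r < 2 ^ k ∧ (2 : ℤ) ^ k ∣ a * (r : ℤ) ^ 2 + b * (r : ℤ) + c := by
  let g : ZMod (2 ^ k) → ZMod (2 ^ k) := fun x => a * x ^ 2 + b * x + c
  have hg : Function.Injective g := by
    intro x y hxy
    obtain ⟨m, rfl⟩ := ZMod.intCast_surjective x
    obtain ⟨n, rfl⟩ := ZMod.intCast_surjective y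
    have h : (((a * n ^ 2 + b * n + c : ℤ)) : ZMod (2 ^ k)) = (a * m ^ 2 + b * m + c : ℤ) := by
      push_cast
      exact hxy.symm
    rw [ZMod.intCast_eq_intCast_iff_dvd_sub, Nat.cast_pow, Nat.cast_ofNat,
      two_pow_dvd_quadratic_sub_iff ha hb] at h
    refine ((ZMod.intCast_eq_intCast_iff_dvd_sub n m (2 ^ k)).mpr ?_).symm
    exact_mod_cast h
  obtain ⟨x, hx⟩ := Finite.surjective_of_injective hg 0
  refine ⟨x.val, x.val_lt, ?_⟩
  have h : ((a * (x.val : ℤ) ^ 2 + b * (x.val : ℤ) + c : ℤ) : ZMod (2 ^ k)) = 0 := by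
    push_cast
    rw [ZMod.natCast_zmod_val]
    exact hx
  rw [ZMod.intCast_zmod_eq_zero_iff_dvd] at h
  exact_mod_cast h

/-- If `a` is even and `b` is odd, the 2-adic valuation tree of
`f(n) = a n² + b n + c` has exactly one infinite branch: at each level `i ≥ 1`
there is a unique residue `r` mod `2^i` along which `2^i ∣ f(n)`, and the
terminating node at level `i` has valuation `i − 1`. -/
theorem stmt_8 (a b c : ℤ) (ha0 : a ≠ 0) (ha : Even a) (hb : Odd b) :
    ∀ i : ℕ, 1 ≤ i → ∃ r : ℕ, r < 2 ^ i ∧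
      (∀ n : ℕ, (n : ℤ) ≡ (r : ℤ) [ZMOD (2 ^ i : ℕ)] →
        (2 : ℤ) ^ i ∣ (a * (n : ℤ) ^ 2 + b * (n : ℤ) + c)) ∧
      (∀ r' : ℕ, r' < 2 ^ i →
        (∀ n : ℕ, (n : ℤ) ≡ (r' : ℤ) [ZMOD (2 ^ i : ℕ)] →
          (2 : ℤ) ^ i ∣ (a * (n : ℤ) ^ 2 + b * (n : ℤ) + c)) → r' = r) ∧
      (∀ n : ℕ, (n : ℤ) ≡ (r : ℤ) [ZMOD (2 ^ (i - 1) : ℕ)] →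
        ¬ ((n : ℤ) ≡ (r : ℤ) [ZMOD (2 ^ i : ℕ)]) →
        padicValInt 2 (a * (n : ℤ) ^ 2 + b * (n : ℤ) + c) = i - 1) := by
  intro i hi
  obtain ⟨r, hr, hroot⟩ := exists_lt_two_pow_dvd_quadratic ha hb c i
  have hmod (k n m : ℕ) :
      (n : ℤ) ≡ (m : ℤ) [ZMOD (2 ^ k : ℕ)] ↔ (2 : ℤ) ^ k ∣ (n : ℤ) - m := by
    rw [Int.modEq_comm, Int.modEq_iff_dvd, Nat.cast_pow, Nat.cast_ofNat]
  have key (k n : ℕ) (hk : k ≤ i) :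
      (2 : ℤ) ^ k ∣ a * (n : ℤ) ^ 2 + b * (n : ℤ) + c ↔
        (n : ℤ) ≡ (r : ℤ) [ZMOD (2 ^ k : ℕ)] := by
    rw [hmod, ← two_pow_dvd_quadratic_sub_iff ha hb c]
    exact (dvd_sub_left ((pow_dvd_pow 2 hk).trans hroot)).symm
  refine ⟨r, hr, fun n => (key i n le_rfl).mpr, fun r' hr' h => ?_, fun n hn hn' => ?_⟩
  · have h' := (key i r' le_rfl).mp (h r' rfl)
    exact (Int.natCast_modEq_iff.mp h').eq_of_lt_of_lt hr' hr
  · rw [← key _ _ (Nat.sub_le i 1)] at hn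
    rw [← key _ _ le_rfl] at hn'
    have h0 : a * (n : ℤ) ^ 2 + b * (n : ℤ) + c ≠ 0 := fun h => hn' (h ▸ dvd_zero _)
    have hval (k : ℕ) : (2 : ℤ) ^ k ∣ a * (n : ℤ) ^ 2 + b * (n : ℤ) + c ↔
        k ≤ padicValInt 2 (a * (n : ℤ) ^ 2 + b * (n : ℤ) + c) := by
      rw [← or_iff_right (b := k ≤ _) h0]
      exact padicValInt_dvd_iff (p := 2) k _
    rw [hval] at hn hn'
    omega
end

section
/- Let f(n) = a n² + b n + c with a, b, c ∈ ℤ, a odd, b odd, and c even. Then for every integer i ≥ 1 there exist residues r₁, r₂ with 0 ≤ r₁, r₂ < 2^{i+1}, r₁ even and r₂ odd, such that for each j ∈ {1, 2}: 2^{i+1} divides f(n) for all n ∈ ℕ with n ≡ r_j (mod 2^{i+1}), and every n ∈ ℕ with n ≡ r_j (mod 2^i) but n ≢ r_j (mod 2^{i+1}) satisfies ν₂(f(n)) = i. -/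
theorem padicValInt_eq_of_dvd_of_not_dvd {p k : ℕ} [Fact p.Prime] {z : ℤ}
    (h : (p : ℤ) ^ k ∣ z) (h' : ¬ (p : ℤ) ^ (k + 1) ∣ z) : padicValInt p z = k := by
  rw [padicValInt_dvd_iff] at h h'
  grind

/-- Along inputs congruent mod `2` to a root mod `2 ^ k`, the quadratic vanishes mod `2 ^ k`
exactly on the residue class of that root. -/
theorem two_pow_dvd_quadratic_iff {a b c n r : ℤ} {k : ℕ} (hb : Odd b)
    (hmod : n ≡ r [ZMOD 2]) (hr : 2 ^ k ∣ a * r ^ 2 + b * r + c) :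
    2 ^ k ∣ a * n ^ 2 + b * n + c ↔ n ≡ r [ZMOD 2 ^ k] := by
  have hsum : Even (n + r) := by
    rw [Int.even_iff]
    have := hmod.eq
    omega
  have hodd : Odd (a * (n + r) + b) := (hsum.mul_left a).add_odd hb
  have hcop : IsCoprime ((2 : ℤ) ^ k) (a * (n + r) + b) :=
    (Int.isCoprime_two_left.2 hodd).pow_left
  rw [Int.modEq_comm, Int.modEq_iff_dvd,
    show a * n ^ 2 + b * n + c = (n - r) * (a * (n + r) + b) + (a * r ^ 2 + b * r + c) by ring,
    dvd_add_left hr]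
  exact ⟨hcop.dvd_of_dvd_mul_right, (·.mul_right _)⟩

/-- Each residue class mod `2` contains a root of the quadratic mod any power of `2`. -/
theorem exists_modEq_two_pow_dvd_quadratic {a b c : ℤ} (ha : Odd a) (hb : Odd b) (hc : Even c)
    (s : ℤ) (k : ℕ) : ∃ r : ℤ, r ≡ s [ZMOD 2] ∧ 2 ^ (k + 1) ∣ a * r ^ 2 + b * r + c := by
  induction k with
  | zero =>
    refine ⟨s, rfl, ?_⟩
    rw [zero_add, pow_one, ← even_iff_two_dvd]
    rcases Int.even_or_odd s with hs | hs
    · simp [Int.even_add, Int.even_pow, hs, hc]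
    · exact ((ha.mul hs.pow).add_odd (hb.mul hs)).add hc
  | succ k ih =>
    obtain ⟨r, hrs, t, ht⟩ := ih
    obtain ⟨m, hm⟩ := hb
    refine ⟨r + 2 ^ (k + 1) * t, ?_, t * (1 + m + a * r + a * 2 ^ k * t), ?_⟩
    · refine Int.ModEq.trans ?_ hrs
      simp [Int.modEq_iff_dvd, pow_succ', mul_assoc]
    · subst hm
      linear_combination ht

theorem exists_nat_residue_two_pow_dvd_quadratic {a b c : ℤ} (ha : Odd a) (hb : Odd b)
    (hc : Even c) (s : ℤ) (k : ℕ) :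
    ∃ r : ℕ, r < 2 ^ (k + 1) ∧ (r : ℤ) ≡ s [ZMOD 2] ∧
      (2 : ℤ) ^ (k + 1) ∣ a * (r : ℤ) ^ 2 + b * r + c := by
  obtain ⟨r, hrs, hr⟩ := exists_modEq_two_pow_dvd_quadratic ha hb hc s k
  have hpos : (0 : ℤ) < 2 ^ (k + 1) := by positivity
  obtain ⟨n, hn⟩ := Int.eq_ofNat_of_zero_le (Int.emod_nonneg r hpos.ne')
  have hnr : (n : ℤ) ≡ r [ZMOD 2 ^ (k + 1)] := hn ▸ Int.mod_modEq r _
  have hmod : (n : ℤ) ≡ r [ZMOD 2] := hnr.of_dvd (dvd_pow_self 2 k.succ_ne_zero)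
  refine ⟨n, ?_, hmod.trans hrs, (two_pow_dvd_quadratic_iff hb hmod hr).2 hnr⟩
  exact_mod_cast hn ▸ Int.emod_lt_of_pos r hpos

/-- If `a` and `b` are odd and `c` is even, the 2-adic valuation tree of
`f(n) = a n² + b n + c` has exactly two infinite branches (one through even and
one through odd inputs): at each level there are residues `r₁` (even) and `r₂`
(odd) mod `2^(i+1)` along which `2^(i+1) ∣ f(n)`, and the terminating nodes at
that level have valuation `i`. -/
theorem stmt_9 (a b c : ℤ) (ha : Odd a) (hb : Odd b) (hc : Even c) :
    ∀ i : ℕ, 1 ≤ i → ∃ r₁ r₂ : ℕ, r₁ < 2 ^ (i + 1) ∧ r₂ < 2 ^ (i + 1) ∧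
      Even r₁ ∧ Odd r₂ ∧
      (∀ r ∈ ({r₁, r₂} : Set ℕ),
        (∀ n : ℕ, (n : ℤ) ≡ (r : ℤ) [ZMOD (2 ^ (i + 1) : ℕ)] →
          (2 : ℤ) ^ (i + 1) ∣ (a * (n : ℤ) ^ 2 + b * (n : ℤ) + c)) ∧
        (∀ n : ℕ, (n : ℤ) ≡ (r : ℤ) [ZMOD (2 ^ i : ℕ)] →
          ¬ ((n : ℤ) ≡ (r : ℤ) [ZMOD (2 ^ (i + 1) : ℕ)]) →
          padicValInt 2 (a * (n : ℤ) ^ 2 + b * (n : ℤ) + c) = i)) := by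
  intro i hi
  obtain ⟨r₁, hlt₁, hpar₁, hdvd₁⟩ := exists_nat_residue_two_pow_dvd_quadratic ha hb hc 0 i
  obtain ⟨r₂, hlt₂, hpar₂, hdvd₂⟩ := exists_nat_residue_two_pow_dvd_quadratic ha hb hc 1 i
  refine ⟨r₁, r₂, hlt₁, hlt₂, ?_, ?_, ?_⟩
  · rw [Nat.even_iff]
    have := hpar₁.eq
    omega
  · rw [Nat.odd_iff]
    have := hpar₂.eq
    omega
  · intro r hr
    have hroot : (2 : ℤ) ^ (i + 1) ∣ a * (r : ℤ) ^ 2 + b * r + c := by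
      rcases hr with rfl | rfl <;> assumption
    push_cast
    refine ⟨fun n hn => ?_, fun n hn hn' => ?_⟩
    · have hmod : (n : ℤ) ≡ r [ZMOD 2] := hn.of_dvd (dvd_pow_self 2 i.succ_ne_zero)
      exact (two_pow_dvd_quadratic_iff hb hmod hroot).2 hn
    · have hmod : (n : ℤ) ≡ r [ZMOD 2] := hn.of_dvd (dvd_pow_self 2 (by omega))
      refine padicValInt_eq_of_dvd_of_not_dvd ?_ ?_
      · exact_mod_cast (two_pow_dvd_quadratic_iff hb hmod
          ((pow_dvd_pow 2 i.le_succ).trans hroot)).2 hn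
      · exact_mod_cast mt (two_pow_dvd_quadratic_iff hb hmod hroot).1 hn'
end

section
/- Let a, b, c ∈ ℤ with a odd and b even, and suppose b² − 4ac = 4^ℓ · Δ for some positive integer ℓ and some integer Δ with Δ ≡ 1 (mod 8). Then the polynomial a x² + b x + c has two distinct roots in the ring ℤ₂ of 2-adic integers: there exist x, y ∈ ℤ₂ with x ≠ y, a x² + b x + c = 0, and a y² + b y + c = 0. -/
/-- An integer congruent to `1` modulo `8` is a square in `ℤ_[2]`. -/
theorem PadicInt.exists_sq_eq_intCast_of_emod_eight_eq_one (Δ : ℤ) (hΔ : Δ % 8 = 1) :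
    ∃ z : ℤ_[2], z ^ 2 = (Δ : ℤ_[2]) := by
  have hnorm : ‖((1 - Δ : ℤ) : ℤ_[2])‖ ≤ ((2 : ℕ) : ℝ) ^ (-(3 : ℕ) : ℤ) :=
    PadicInt.norm_int_le_pow_iff_dvd.2 (by norm_num; omega)
  have htwo : ‖(2 : ℤ_[2])‖ = (2 : ℝ)⁻¹ := by simpa using PadicInt.norm_p (p := 2)
  obtain ⟨z, hz, -⟩ := hensels_lemma (p := 2)
    (F := (Polynomial.X ^ 2 - Polynomial.C (Δ : ℤ_[2]) : Polynomial ℤ_[2])) (a := 1) (by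
      have h : ‖(1 : ℤ_[2]) - (Δ : ℤ_[2])‖ ≤ 1 / 8 := by
        push_cast at hnorm
        exact hnorm.trans (by norm_num)
      simp only [Polynomial.coe_aeval_eq_eval, Polynomial.derivative_sub,
        Polynomial.derivative_X_pow, Polynomial.derivative_C, Polynomial.eval_sub,
        Polynomial.eval_pow, Polynomial.eval_X, Polynomial.eval_C, Polynomial.eval_mul,
        one_pow, mul_one, sub_zero, Nat.cast_ofNat, htwo]
      exact h.trans_lt (by norm_num))
  exact ⟨z, by simpa [sub_eq_zero] using hz⟩

/-- If `a` is odd, `b` even, and `b² − 4ac = 4^ℓ Δ` with `ℓ ≥ 1` and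
`Δ ≡ 1 (mod 8)`, then `a x² + b x + c` has two distinct roots in `ℤ_[2]`. -/
theorem stmt_10 (a b c : ℤ) (ha : Odd a) (hb : Even b) (ℓ : ℕ) (hℓ : 1 ≤ ℓ) (Δ : ℤ)
    (hΔ : Δ % 8 = 1) (hdisc : b ^ 2 - 4 * a * c = 4 ^ ℓ * Δ) :
    ∃ x y : ℤ_[2], x ≠ y ∧
      (a : ℤ_[2]) * x ^ 2 + (b : ℤ_[2]) * x + (c : ℤ_[2]) = 0 ∧
      (a : ℤ_[2]) * y ^ 2 + (b : ℤ_[2]) * y + (c : ℤ_[2]) = 0 := by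
  obtain ⟨z, hz⟩ := PadicInt.exists_sq_eq_intCast_of_emod_eight_eq_one Δ hΔ
  obtain ⟨β, rfl⟩ := hb.exists_two_nsmul
  obtain ⟨k, rfl⟩ := Nat.exists_eq_add_of_le' hℓ
  have hunit : IsUnit (a : ℤ_[2]) := by
    by_contra h
    rw [PadicInt.not_isUnit_iff, PadicInt.norm_int_lt_one_iff_dvd] at h
    obtain ⟨m, rfl⟩ := ha
    push_cast at h
    omega
  obtain ⟨u, hu⟩ := hunit.exists_right_inv
  have hz0 : z ≠ 0 := by
    rintro rfl
    have : Δ = 0 := by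
      rw [zero_pow two_ne_zero] at hz
      exact_mod_cast hz.symm
    omega
  have hu0 : u ≠ 0 := by
    rintro rfl
    simp at hu
  have hd : (β : ℤ_[2]) ^ 2 - a * c = (2 ^ k * z) ^ 2 := by
    have h : β ^ 2 - a * c = 4 ^ k * Δ := by
      rw [nsmul_eq_mul, pow_succ 4] at hdisc
      push_cast at hdisc
      linarith
    rw [mul_pow, hz, ← pow_mul, mul_comm k 2, pow_mul]
    norm_num
    exact_mod_cast h
  have hw : (2 : ℤ_[2]) ^ k * z ≠ 0 := mul_ne_zero (pow_ne_zero _ two_ne_zero) hz0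
  generalize (2 : ℤ_[2]) ^ k * z = w at hd hw
  refine ⟨u * (-β + w), u * (-β - w), ?_, ?_, ?_⟩
  · intro h
    have h' : 2 * w = 0 := by linear_combination mul_left_cancel₀ hu0 h
    exact hw ((mul_eq_zero.1 h').resolve_left two_ne_zero)
  · push_cast [nsmul_eq_mul]
    linear_combination (u * (-β + w) ^ 2 - c) * hu - u * hd
  · push_cast [nsmul_eq_mul]
    linear_combination (u * (-β - w) ^ 2 - c) * hu - u * hd
end

section
/- Let f(n) = a n² + b n + c with a, b, c ∈ ℤ, a odd, b even, and suppose b² − 4ac = 4Δ where the integer Δ satisfies Δ ≡ 5 (mod 8). Then f(n) ≠ 0 for all n ∈ ℕ and: if b ≡ 0 (mod 4), then ν₂(f(n)) = 0 for n even and ν₂(f(n)) = 2 for n odd; if b ≡ 2 (mod 4), then ν₂(f(n)) = 2 for n even and ν₂(f(n)) = 0 for n odd. -/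
/-- Completing the square: `a f(n) = (a n + k)² - Δ` when `b = 2 k`. -/
theorem mul_quadratic_eq_sq_sub {a k c Δ : ℤ} (hdisc : (2 * k) ^ 2 - 4 * a * c = 4 * Δ) (n : ℤ) :
    a * (a * n ^ 2 + 2 * k * n + c) = (a * n + k) ^ 2 - Δ := by
  apply mul_left_cancel₀ (four_ne_zero (α := ℤ))
  linear_combination -hdisc

theorem emod_two_eq_one_of_mul_eq_sq_sub {a x y Δ : ℤ} (hm : Δ % 8 = 5) (hx : Even x)
    (h : a * y = x ^ 2 - Δ) : y % 2 = 1 := by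
  have hodd : Odd (a * y) := by
    rw [h]
    exact (hx.pow_of_ne_zero two_ne_zero).sub_odd (Int.odd_iff.mpr (by lia))
  exact Int.odd_iff.mp (Int.odd_mul.mp hodd).2

theorem emod_eight_eq_four_of_mul_eq_sq_sub {a x y Δ : ℤ} (ha : Odd a) (hm : Δ % 8 = 5)
    (hx : Odd x) (h : a * y = x ^ 2 - Δ) : y % 8 = 4 := by
  have hx8 : (8 : ℤ) ∣ x ^ 2 - 1 := Int.eight_dvd_sq_sub_one_of_odd hx
  obtain ⟨u, hu⟩ : (8 : ℤ) ∣ a ^ 2 - 1 := Int.eight_dvd_sq_sub_one_of_odd ha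
  obtain ⟨w, hw⟩ : ∃ w, x ^ 2 - Δ = 8 * w + 4 := ⟨(x ^ 2 - Δ - 4) / 8, by lia⟩
  obtain ⟨v, hv⟩ := ha
  have hy : y = 8 * (a * w + v - u * y) + 4 := by
    linear_combination a * h + a * hw - y * hu + 4 * hv
  lia

theorem padicValInt_two_eq_zero_of_emod {y : ℤ} (hy : y % 2 = 1) : padicValInt 2 y = 0 :=
  padicValInt.eq_zero_of_not_dvd (by lia)

theorem padicValInt_two_eq_two_of_emod {y : ℤ} (hy : y % 8 = 4) : padicValInt 2 y = 2 := by
  obtain ⟨z, rfl⟩ : ∃ z, y = 2 * (2 * z) := ⟨y / 4, by lia⟩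
  have hz : z % 2 = 1 := by lia
  have htwo : padicValInt 2 (2 : ℤ) = 1 := padicValInt_self
  rw [padicValInt.mul two_ne_zero (by lia), padicValInt.mul two_ne_zero (by lia), htwo,
    padicValInt_two_eq_zero_of_emod hz]

/-- Case `ℓ = 1`, `m = 5` of Lemma on one-level trees: valuations of
`f(n) = a n² + b n + c` according to the parity of `n` and `b mod 4`. -/
theorem stmt_14 (a b c : ℤ) (ha : Odd a) (hb : Even b) (Δ : ℤ)
    (hdisc : b ^ 2 - 4 * a * c = 4 * Δ) (hm : Δ % 8 = 5) :
    (∀ n : ℕ, a * (n : ℤ) ^ 2 + b * (n : ℤ) + c ≠ 0) ∧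
    (b % 4 = 0 → ∀ n : ℕ,
      (Even n → padicValInt 2 (a * (n : ℤ) ^ 2 + b * (n : ℤ) + c) = 0) ∧
      (Odd n → padicValInt 2 (a * (n : ℤ) ^ 2 + b * (n : ℤ) + c) = 2)) ∧
    (b % 4 = 2 → ∀ n : ℕ,
      (Even n → padicValInt 2 (a * (n : ℤ) ^ 2 + b * (n : ℤ) + c) = 2) ∧
      (Odd n → padicValInt 2 (a * (n : ℤ) ^ 2 + b * (n : ℤ) + c) = 0)) := by
  obtain ⟨k, rfl⟩ := hb.exists_two_nsmul
  simp only [nsmul_eq_mul, Nat.cast_ofNat] at hdisc ⊢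
  have hsq (n : ℕ) := mul_quadratic_eq_sq_sub hdisc (n : ℤ)
  have heven (n : ℕ) (hx : Even (a * n + k)) :=
    emod_two_eq_one_of_mul_eq_sq_sub hm hx (hsq n)
  have hodd (n : ℕ) (hx : Odd (a * n + k)) :=
    emod_eight_eq_four_of_mul_eq_sq_sub ha hm hx (hsq n)
  refine ⟨fun n h0 => ?_, fun hk n => ?_, fun hk n => ?_⟩
  · rcases Int.even_or_odd (a * n + k) with hx | hx
    · have := heven n hx
      lia
    · have := hodd n hx
      lia
  · have hk : Even k := Int.even_iff.mpr (by lia)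
    refine ⟨fun hn => padicValInt_two_eq_zero_of_emod (heven n ?_),
      fun hn => padicValInt_two_eq_two_of_emod (hodd n ?_)⟩
    · exact (((Int.even_coe_nat n).mpr hn).mul_left a).add hk
    · exact (ha.mul ((Int.odd_coe_nat n).mpr hn)).add_even hk
  · have hk : Odd k := Int.odd_iff.mpr (by lia)
    refine ⟨fun hn => padicValInt_two_eq_two_of_emod (hodd n ?_),
      fun hn => padicValInt_two_eq_zero_of_emod (heven n ?_)⟩
    · exact (((Int.even_coe_nat n).mpr hn).mul_left a).add_odd hk
    · exact (ha.mul ((Int.odd_coe_nat n).mpr hn)).add_odd hk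
end

section
/- Let f(n) = a n² + b n + c with a, b, c ∈ ℤ, a odd, b even, and suppose b² − 4ac = 4^ℓ · Δ with ℓ ≥ 2 an integer and Δ an integer whose residue modulo 8 lies in {2, 3, 5, 6, 7}. Then f(n) ≠ 0 for all n ∈ ℕ, and for every integer i with 1 ≤ i < ℓ there exists a unique residue r with 0 ≤ r < 2^i such that ν₂(f(n)) ≥ 2i for all n ∈ ℕ with n ≡ r (mod 2^i); moreover, every n ∈ ℕ with n ≡ r (mod 2^{i−1}) but n ≢ r (mod 2^i) satisfies ν₂(f(n)) = 2(i−1). -/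
theorem two_pow_dvd_odd_mul_iff {a : ℤ} (ha : Odd a) {j : ℕ} {x : ℤ} :
    2 ^ j ∣ a * x ↔ 2 ^ j ∣ x :=
  ⟨(Int.isCoprime_two_left.mpr ha).pow_left.dvd_of_dvd_mul_left, fun h => h.mul_left a⟩

theorem not_isSquare_of_emod_eight {Δ : ℤ}
    (hm : Δ % 8 = 2 ∨ Δ % 8 = 3 ∨ Δ % 8 = 5 ∨ Δ % 8 = 6 ∨ Δ % 8 = 7) (t : ℤ) : t ^ 2 ≠ Δ := by
  rintro rfl
  have h : t % 8 = 0 ∨ t % 8 = 1 ∨ t % 8 = 2 ∨ t % 8 = 3 ∨ t % 8 = 4 ∨ t % 8 = 5 ∨ t % 8 = 6 ∨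
      t % 8 = 7 := by omega
  rcases h with h | h | h | h | h | h | h | h <;> simp [pow_two, Int.mul_emod, h] at hm

/-- If `a * F` is a square minus `4 ^ m * Δ` with `a` odd, then for `i ≤ m` divisibility of `F` by
`4 ^ i` is divisibility of the square root by `2 ^ i`. -/
theorem two_pow_dvd_iff_of_mul_eq_sq_sub {a F x Δ : ℤ} {m i : ℕ} (ha : Odd a)
    (h : a * F = x ^ 2 - 4 ^ m * Δ) (hi : i ≤ m) : 2 ^ (2 * i) ∣ F ↔ 2 ^ i ∣ x := by
  have h4 : (2 : ℤ) ^ (2 * i) ∣ 4 ^ m * Δ := by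
    rw [pow_mul]
    exact Dvd.dvd.mul_right (by norm_num; exact pow_dvd_pow 4 hi) _
  rw [← two_pow_dvd_odd_mul_iff ha, h, dvd_sub_left h4, mul_comm 2 i, pow_mul]
  exact Int.pow_dvd_pow_iff two_ne_zero

/-- If `x` is exactly divisible by `2 ^ j` with `j < m`, then `F` is exactly divisible by `4 ^ j`. -/
theorem not_two_pow_succ_dvd_of_mul_eq_sq_sub {a F x Δ : ℤ} {m j : ℕ}
    (h : a * F = x ^ 2 - 4 ^ m * Δ) (hj : j < m) (hx : (2 : ℤ) ^ j ∣ x)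
    (hx' : ¬ (2 : ℤ) ^ (j + 1) ∣ x) : ¬ (2 : ℤ) ^ (2 * j + 1) ∣ F := by
  obtain ⟨t, rfl⟩ := hx
  rintro ⟨s, rfl⟩
  obtain ⟨d, rfl⟩ := Nat.exists_eq_add_of_lt hj
  have hE : a * (2 * s) = t ^ 2 - 4 ^ (d + 1) * Δ := by
    have h0 : (4 : ℤ) ^ j ≠ 0 := by positivity
    apply mul_left_cancel₀ h0
    have h2 : (2 : ℤ) ^ (2 * j) = 4 ^ j := by rw [pow_mul]; norm_num
    have h3 : ((2 : ℤ) ^ j) ^ 2 = 4 ^ j := by rw [← pow_mul, mul_comm, h2]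
    rw [pow_succ, h2, mul_pow, h3] at h
    linear_combination h
  have ht : (2 : ℤ) ∣ t ^ 2 := ⟨a * s + 2 * 4 ^ d * Δ, by linear_combination -hE⟩
  obtain ⟨v, rfl⟩ := Int.prime_two.dvd_of_dvd_pow ht
  exact hx' ⟨v, by ring⟩

theorem exists_modEq_iff_dvd_mul_add {a : ℤ} (ha : Odd a) (k : ℤ) (i : ℕ) :
    ∃ r : ℕ, r < 2 ^ i ∧
      ∀ (j : ℕ) (n : ℤ), j ≤ i → (n ≡ (r : ℤ) [ZMOD (2 ^ j : ℕ)] ↔ 2 ^ j ∣ a * n + k) := by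
  obtain ⟨u, v, huv⟩ : IsCoprime ((2 : ℤ) ^ i) a := (Int.isCoprime_two_left.mpr ha).pow_left
  have hpos : (0 : ℤ) < 2 ^ i := by positivity
  obtain ⟨r, hr⟩ := Int.eq_ofNat_of_zero_le (Int.emod_nonneg (-k * v) hpos.ne')
  have hlt := Int.emod_lt_of_pos (-k * v) hpos
  rw [hr] at hlt
  refine ⟨r, by exact_mod_cast hlt, fun j n hj => ?_⟩
  have hr' : (2 : ℤ) ^ i ∣ a * r + k := by
    have h := Int.emod_add_mul_ediv (-k * v) (2 ^ i)
    rw [hr] at h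
    exact ⟨k * u - a * (-k * v / 2 ^ i), by linear_combination a * h - k * huv⟩
  rw [Int.modEq_comm, Int.modEq_iff_dvd, ← dvd_sub_left ((pow_dvd_pow 2 hj).trans hr'),
    show a * n + k - (a * r + k) = a * (n - r) by ring, two_pow_dvd_odd_mul_iff ha]
  norm_num


/-- Levels `1 ≤ i < ℓ` of the finite 2-adic valuation tree of
`f(n) = a n² + b n + c` in the bounded case: at each such level there is a
unique residue `r` mod `2^i` with `ν₂(f(n)) ≥ 2i` along it, and every `n`
agreeing with `r` mod `2^(i−1)` but not mod `2^i` has `ν₂(f(n)) = 2(i−1)`. -/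
theorem stmt_15 (a b c : ℤ) (ha : Odd a) (hb : Even b) (ℓ : ℕ) (hℓ : 2 ≤ ℓ) (Δ : ℤ)
    (hdisc : b ^ 2 - 4 * a * c = 4 ^ ℓ * Δ)
    (hm : Δ % 8 = 2 ∨ Δ % 8 = 3 ∨ Δ % 8 = 5 ∨ Δ % 8 = 6 ∨ Δ % 8 = 7) :
    (∀ n : ℕ, a * (n : ℤ) ^ 2 + b * (n : ℤ) + c ≠ 0) ∧
    ∀ i : ℕ, 1 ≤ i → i < ℓ → ∃ r : ℕ, r < 2 ^ i ∧
      (∀ n : ℕ, (n : ℤ) ≡ (r : ℤ) [ZMOD (2 ^ i : ℕ)] →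
        2 * i ≤ padicValInt 2 (a * (n : ℤ) ^ 2 + b * (n : ℤ) + c)) ∧
      (∀ r' : ℕ, r' < 2 ^ i →
        (∀ n : ℕ, (n : ℤ) ≡ (r' : ℤ) [ZMOD (2 ^ i : ℕ)] →
          2 * i ≤ padicValInt 2 (a * (n : ℤ) ^ 2 + b * (n : ℤ) + c)) → r' = r) ∧
      (∀ n : ℕ, (n : ℤ) ≡ (r : ℤ) [ZMOD (2 ^ (i - 1) : ℕ)] →
        ¬ ((n : ℤ) ≡ (r : ℤ) [ZMOD (2 ^ i : ℕ)]) →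
        padicValInt 2 (a * (n : ℤ) ^ 2 + b * (n : ℤ) + c) = 2 * (i - 1)) := by
  obtain ⟨k, rfl⟩ := hb
  obtain ⟨m, rfl⟩ : ∃ m, ℓ = m + 1 := ⟨ℓ - 1, by omega⟩
  have hF : ∀ n : ℤ, a * (a * n ^ 2 + (k + k) * n + c) = (a * n + k) ^ 2 - 4 ^ m * Δ := by
    intro n
    rw [pow_succ (4 : ℤ)] at hdisc
    linarith
  have hne : ∀ n : ℤ, a * n ^ 2 + (k + k) * n + c ≠ 0 := by
    intro n h0
    have h := hF n
    obtain ⟨t, ht⟩ := (two_pow_dvd_iff_of_mul_eq_sq_sub ha h le_rfl).mp (h0 ▸ dvd_zero _)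
    rw [h0, ht, mul_pow, ← pow_mul, mul_comm m 2, pow_mul] at h
    norm_num at h
    apply not_isSquare_of_emod_eight hm t
    have h4 : (4 : ℤ) ^ m ≠ 0 := by positivity
    exact mul_left_cancel₀ h4 (by linarith)
  have hval : ∀ (n : ℤ) (j : ℕ), j ≤ padicValInt 2 (a * n ^ 2 + (k + k) * n + c) ↔
      (2 : ℤ) ^ j ∣ a * n ^ 2 + (k + k) * n + c := by
    intro n j
    have h := padicValInt_dvd_iff (p := 2) j (a * n ^ 2 + (k + k) * n + c)
    simpa [hne n] using h.symm
  refine ⟨fun n => hne n, fun i hi hil => ?_⟩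
  obtain ⟨r, hr, hmod⟩ := exists_modEq_iff_dvd_mul_add ha k i
  have hlev : ∀ n : ℤ, 2 * i ≤ padicValInt 2 (a * n ^ 2 + (k + k) * n + c) ↔
      n ≡ (r : ℤ) [ZMOD (2 ^ i : ℕ)] := fun n => by
    rw [hval, hmod i n le_rfl, two_pow_dvd_iff_of_mul_eq_sq_sub ha (hF n) (by omega)]
  refine ⟨r, hr, fun n hn => (hlev n).mpr hn, fun r' hr' h => ?_, fun n hn hn' => ?_⟩
  · have h' := Int.natCast_modEq_iff.mp ((hlev r').mp (h r' rfl))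
    exact h'.eq_of_lt_of_lt hr' hr
  · obtain ⟨j, rfl⟩ : ∃ j, i = j + 1 := ⟨i - 1, by omega⟩
    rw [Nat.add_sub_cancel] at hn ⊢
    rw [hmod _ _ (by omega)] at hn hn'
    have h1 := (hval n (2 * j)).mpr
      ((two_pow_dvd_iff_of_mul_eq_sq_sub ha (hF n) (by omega)).mpr hn)
    have h2 := (hval n (2 * j + 1)).not.mpr
      (not_two_pow_succ_dvd_of_mul_eq_sq_sub (hF n) (by omega) hn hn')
    omega
end

section
/- Let f(n) = a n² + b n + c with a, b, c ∈ ℤ, a odd, b = 2k even, and suppose b² − 4ac = 4^ℓ · Δ with ℓ ≥ 2 an integer and Δ an integer whose residue m = Δ mod 8 lies in {2, 3, 5, 6, 7}. Let n ∈ ℕ satisfy 2^{ℓ−1} ∣ (a n + k). Then f(n) ≠ 0 and: (i) if 2^ℓ ∣ (a n + k), then ν₂(f(n)) = 2(ℓ−1) when m ∈ {3, 5, 7} and ν₂(f(n)) = 2ℓ − 1 when m ∈ {2, 6}; (ii) if 2^ℓ ∤ (a n + k), then ν₂(f(n)) = 2(ℓ−1) when m ∈ {2, 6}, ν₂(f(n))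 = 2ℓ − 1 when m ∈ {3, 7}, and ν₂(f(n)) = 2ℓ when m = 5. -/
theorem padicValInt_two_of_odd {x : ℤ} (hx : Odd x) : padicValInt 2 x = 0 :=
  padicValInt.eq_zero_of_not_dvd fun h => Int.not_even_iff_odd.mpr hx (even_iff_two_dvd.mpr h)

theorem padicValInt_two_of_odd_mul_eq {a x y w : ℤ} {e s : ℕ} (ha : Odd a) (hw : Odd w)
    (hy : y = 2 ^ s * w) (h : a * x = 2 ^ e * y) : x ≠ 0 ∧ padicValInt 2 x = e + s := by
  have ha0 : a ≠ 0 := by rintro rfl; simp at ha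
  have hw0 : w ≠ 0 := by rintro rfl; simp at hw
  have h' : a * x = ((2 : ℕ) ^ (e + s) : ℤ) * w := by rw [h, hy]; push_cast; ring
  have hpow : ((2 : ℕ) ^ (e + s) : ℤ) ≠ 0 := by positivity
  have hx : x ≠ 0 := by
    rintro rfl
    rw [mul_zero] at h'
    exact mul_ne_zero hpow hw0 h'.symm
  refine ⟨hx, ?_⟩
  have hv := congrArg (padicValInt 2) h'
  rw [padicValInt.mul ha0 hx, padicValInt.mul hpow hw0, padicValInt_two_of_odd ha,
    padicValInt_two_of_odd hw, zero_add, add_zero] at hv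
  rw [hv, ← Nat.cast_pow, padicValInt.of_nat, padicValNat.prime_pow]


/-- Valuations at the terminating nodes of the final (`ℓ`-th) level of the finite
2-adic valuation tree of `f(n) = a n² + b n + c`, where `b = 2k` and
`2^(ℓ−1) ∣ (a n + k)`. -/
theorem stmt_16 (a b c k : ℤ) (ha : Odd a) (hb : b = 2 * k) (ℓ : ℕ) (hℓ : 2 ≤ ℓ)
    (Δ : ℤ) (hdisc : b ^ 2 - 4 * a * c = 4 ^ ℓ * Δ) (m : ℤ) (hm : m = Δ % 8)
    (hmem : m = 2 ∨ m = 3 ∨ m = 5 ∨ m = 6 ∨ m = 7)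
    (n : ℕ) (hn : (2 : ℤ) ^ (ℓ - 1) ∣ (a * (n : ℤ) + k)) :
    (a * (n : ℤ) ^ 2 + b * (n : ℤ) + c ≠ 0) ∧
    ((2 : ℤ) ^ ℓ ∣ (a * (n : ℤ) + k) →
      ((m = 3 ∨ m = 5 ∨ m = 7) →
        padicValInt 2 (a * (n : ℤ) ^ 2 + b * (n : ℤ) + c) = 2 * (ℓ - 1)) ∧
      ((m = 2 ∨ m = 6) →
        padicValInt 2 (a * (n : ℤ) ^ 2 + b * (n : ℤ) + c) = 2 * ℓ - 1)) ∧
    (¬ ((2 : ℤ) ^ ℓ ∣ (a * (n : ℤ) + k)) →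
      ((m = 2 ∨ m = 6) →
        padicValInt 2 (a * (n : ℤ) ^ 2 + b * (n : ℤ) + c) = 2 * (ℓ - 1)) ∧
      ((m = 3 ∨ m = 7) →
        padicValInt 2 (a * (n : ℤ) ^ 2 + b * (n : ℤ) + c) = 2 * ℓ - 1) ∧
      (m = 5 →
        padicValInt 2 (a * (n : ℤ) ^ 2 + b * (n : ℤ) + c) = 2 * ℓ)) := by
  obtain ⟨j, rfl⟩ : ∃ j, ℓ = j + 1 := ⟨ℓ - 1, by omega⟩
  obtain ⟨t, ht⟩ := hn
  rw [Nat.add_sub_cancel] at ht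
  have key : a * (a * (n : ℤ) ^ 2 + b * (n : ℤ) + c) = 2 ^ (2 * j) * (t ^ 2 - Δ) := by
    have h4 : (4 : ℤ) ^ (j + 1) = 4 * (2 ^ j) ^ 2 := by
      rw [pow_succ', ← pow_mul, mul_comm j 2, pow_mul]; norm_num
    subst hb
    rw [h4] at hdisc
    rw [mul_comm 2 j, pow_mul]
    refine mul_left_cancel₀ (four_ne_zero (α := ℤ)) ?_
    linear_combination 4 * (a * n + k + 2 ^ j * t) * ht - hdisc
  have hdvd : (2 : ℤ) ^ (j + 1) ∣ a * (n : ℤ) + k ↔ 2 ∣ t := by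
    rw [ht, pow_succ]
    exact mul_dvd_mul_iff_left (by positivity)
  have hval : ∀ (s : ℕ) (w : ℤ), t ^ 2 - Δ = 2 ^ s * (2 * w + 1) →
      a * (n : ℤ) ^ 2 + b * (n : ℤ) + c ≠ 0 ∧
        padicValInt 2 (a * (n : ℤ) ^ 2 + b * (n : ℤ) + c) = 2 * j + s :=
    fun s w h => padicValInt_two_of_odd_mul_eq ha ⟨w, rfl⟩ h key
  rw [hdvd]
  generalize a * (n : ℤ) ^ 2 + b * (n : ℤ) + c = F at hval ⊢
  obtain ⟨q, hq⟩ : ∃ q, Δ = 8 * q + m := ⟨Δ / 8, by omega⟩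
  rcases Int.even_or_odd' t with ⟨r, hr | hr⟩
  · have hsq : t ^ 2 = 4 * r ^ 2 := by rw [hr]; ring
    generalize r ^ 2 = z at hsq
    have h0 := hval 0 ((t ^ 2 - Δ) / 2)
    have h1 := hval 1 ((t ^ 2 - Δ) / 4)
    by_cases hm' : m = 2 ∨ m = 6
    · obtain ⟨hF, hv⟩ := h1 (by omega)
      exact ⟨hF, by omega, by omega⟩
    · obtain ⟨hF, hv⟩ := h0 (by omega)
      exact ⟨hF, by omega, by omega⟩
  · obtain ⟨z, hz⟩ : ∃ z, t ^ 2 = 8 * z + 1 := by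
      obtain ⟨z, hz⟩ := Int.even_mul_succ_self r
      exact ⟨z, by rw [hr]; linear_combination 4 * hz⟩
    have h0 := hval 0 ((t ^ 2 - Δ) / 2)
    have h1 := hval 1 ((t ^ 2 - Δ) / 4)
    have h2 := hval 2 ((t ^ 2 - Δ) / 8)
    by_cases hm' : m = 2 ∨ m = 6
    · obtain ⟨hF, hv⟩ := h0 (by omega)
      exact ⟨hF, by omega, by omega⟩
    by_cases hm5 : m = 5
    · obtain ⟨hF, hv⟩ := h2 (by omega)
      exact ⟨hF, by omega, by omega⟩
    · obtain ⟨hF, hv⟩ := h1 (by omega)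
      exact ⟨hF, by omega, by omega⟩
end
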